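/- Bias of the clipped logit of a Gaussian-perturbed binomial proportion (Lemma H.1): Fix ε, δ ∈ (0,1), β ∈ (1/2, 1), n ∈ ℕ with n ≥ 1, and p ∈ [1−β, β]. Let Y_n ~ Binomial(n, p) and X̃_n = Y_n/n + ξ_n, where ξ_n is an independent Gaussian random variable with mean 0 and variance 2·log(1.25/δ)/(εn)². Then |E[f(X̃_n)] − f(E[X̃_n])| ≤ 3/((1−β)^4·√(2n)) + 4·√(log(1.25/δ))/((1−β)^4·εn). -/

import Mathlib

open MeasureTheory ProbabilityTheory

/-- The clipped logit function `f` of Lemma F.1: `f(x) = log(x/(1−x))` on `(1−β, β)`,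
clamped to its boundary values outside. -/
noncomputable def flog (β x : ℝ) : ℝ :=
  if x ≤ 1 - β then Real.log ((1 - β) / β)
  else if β ≤ x then Real.log (β / (1 - β))
  else Real.log (x / (1 - x))

/-- `Y` has the binomial law with `m` trials and success probability `p` under `P`. -/
def HasBinomialLaw {Ω : Type*} [MeasurableSpace Ω] (P : Measure Ω)
    (Y : Ω → ℕ) (m : ℕ) (p : ℝ) : Prop :=
  ∀ t : ℕ, P {ω | Y ω = t} =
    ENNReal.ofReal ((m.choose t : ℝ) * p ^ t * (1 - p) ^ (m - t))

theorem aux_log_le {a b c : ℝ} (hc : 0 < c) (hb : c ≤ b) (hab : b ≤ a) :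
    0 ≤ Real.log a - Real.log b ∧ Real.log a - Real.log b ≤ (a - b) / c := by
  have hb0 : 0 < b := lt_of_lt_of_le hc hb
  have ha0 : 0 < a := lt_of_lt_of_le hb0 hab
  constructor
  · have := Real.log_le_log hb0 hab
    linarith
  · rw [← Real.log_div ha0.ne' hb0.ne']
    have h1 := Real.log_le_sub_one_of_pos (div_pos ha0 hb0)
    have h2 : a / b - 1 = (a - b) / b := by field_simp
    have h3 : (a - b) / b ≤ (a - b) / c :=
      div_le_div_of_nonneg_left (by linarith) hc hb
    linarith

theorem aux_flog_eq {β : ℝ} (hβ : β ∈ Set.Ioo (1 / 2 : ℝ) 1) (x : ℝ) :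
    flog β x = Real.log (max (1 - β) (min x β)) - Real.log (1 - max (1 - β) (min x β)) := by
  obtain ⟨h1, h2⟩ := hβ
  unfold flog
  split_ifs with h h'
  · rw [min_eq_left (by linarith), max_eq_left h, Real.log_div (by linarith) (by linarith)]
    congr 2
    ring
  · rw [min_eq_right h', max_eq_right (by linarith), Real.log_div (by linarith) (by linarith)]
  · push Not at h h'
    rw [min_eq_left h'.le, max_eq_right h.le, Real.log_div (by linarith) (by linarith)]

theorem aux_flog_le {β : ℝ} (hβ : β ∈ Set.Ioo (1 / 2 : ℝ) 1) {x y : ℝ} (hxy : y ≤ x) :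
    |flog β x - flog β y| ≤ 2 / (1 - β) * |x - y| := by
  rw [aux_flog_eq hβ, aux_flog_eq hβ]
  obtain ⟨h1, h2⟩ := hβ
  have hc : 0 < 1 - β := by linarith
  set a := max (1 - β) (min x β) with ha
  set b := max (1 - β) (min y β) with hb
  have hab : b ≤ a := max_le_max le_rfl (min_le_min hxy le_rfl)
  have hb1 : 1 - β ≤ b := le_max_left _ _
  have ha1 : a ≤ β := max_le (by linarith) (min_le_right _ _)
  have hd : a - b ≤ x - y := by
    rw [ha, hb]
    rcases max_cases (1 - β) (min x β) with h | h <;>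
    rcases max_cases (1 - β) (min y β) with h' | h' <;>
    rcases min_cases x β with h3 | h3 <;>
    rcases min_cases y β with h4 | h4 <;> linarith
  obtain ⟨p1, p2⟩ := aux_log_le hc hb1 hab
  obtain ⟨q1, q2⟩ := aux_log_le (a := 1 - b) (b := 1 - a) hc (by linarith) (by linarith)
  rw [abs_of_nonneg (by linarith), abs_of_nonneg (by linarith)]
  have h5 : (a - b) / (1 - β) ≤ (x - y) / (1 - β) := by gcongr
  have h6 : (1 - b - (1 - a)) / (1 - β) = (a - b) / (1 - β) := by congr 1; ring
  have h7 : 2 / (1 - β) * (x - y) = 2 * ((x - y) / (1 - β)) := by ring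
  linarith

theorem aux_flog_lip {β : ℝ} (hβ : β ∈ Set.Ioo (1 / 2 : ℝ) 1) (x y : ℝ) :
    |flog β x - flog β y| ≤ 2 / (1 - β) * |x - y| := by
  rcases le_total y x with h | h
  · exact aux_flog_le hβ h
  · rw [abs_sub_comm, abs_sub_comm x y]
    exact aux_flog_le hβ h

theorem aux_flog_meas {β : ℝ} (hβ : β ∈ Set.Ioo (1 / 2 : ℝ) 1) : Measurable (flog β) := by
  have : flog β = fun x => Real.log (max (1 - β) (min x β)) -
      Real.log (1 - max (1 - β) (min x β)) := funext (aux_flog_eq hβ)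
  rw [this]
  fun_prop

theorem aux_map {Ω : Type*} [MeasurableSpace Ω] {P : Measure Ω} {Y : Ω → ℕ} (hY : Measurable Y)
    {n : ℕ} {p : ℝ} (hlaw : HasBinomialLaw P Y n p) :
    P.map Y = ∑ t ∈ Finset.range (n + 1),
      ENNReal.ofReal ((n.choose t : ℝ) * p ^ t * (1 - p) ^ (n - t)) • Measure.dirac t := by
  apply Measure.ext_of_singleton
  intro a
  rw [Measure.map_apply hY (measurableSet_singleton a)]
  have h := hlaw a
  have : Y ⁻¹' {a} = {ω | Y ω = a} := rfl
  rw [this, h]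
  simp only [Measure.finsetSum_apply, Measure.smul_apply, smul_eq_mul]
  by_cases ha : a ∈ Finset.range (n + 1)
  · rw [Finset.sum_eq_single_of_mem a ha]
    · simp
    · intro b _ hb
      simp [hb]
  · rw [Finset.sum_eq_zero]
    · rw [Nat.choose_eq_zero_of_lt (by simpa using ha)]
      simp
    · intro b hb
      have : b ≠ a := fun h => ha (h ▸ hb)
      simp [this]

theorem aux_integrable {Ω : Type*} [MeasurableSpace Ω] {P : Measure Ω} {Y : Ω → ℕ}
    (hY : Measurable Y)
    {n : ℕ} {p : ℝ} (hlaw : HasBinomialLaw P Y n p) (g : ℕ → ℝ) :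
    Integrable (fun ω => g (Y ω)) P := by
  have : Integrable g (P.map Y) := by
    rw [aux_map hY hlaw, integrable_finsetSum_measure]
    intro i _
    exact (integrable_dirac (by simp)).smul_measure ENNReal.ofReal_ne_top
  exact this.comp_measurable hY

theorem aux_integral {Ω : Type*} [MeasurableSpace Ω] {P : Measure Ω} {Y : Ω → ℕ}
    (hY : Measurable Y)
    {n : ℕ} {p : ℝ} (hp0 : 0 ≤ p) (hp1 : p ≤ 1) (hlaw : HasBinomialLaw P Y n p) (g : ℕ → ℝ) :
    ∫ ω, g (Y ω) ∂P = ∑ t ∈ Finset.range (n + 1),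
      ((n.choose t : ℝ) * p ^ t * (1 - p) ^ (n - t)) * g t := by
  rw [← integral_map (f := g) hY.aemeasurable (by fun_prop), aux_map hY hlaw,
    integral_finsetSum_measure]
  · apply Finset.sum_congr rfl
    intro t _
    have : 0 ≤ (n.choose t : ℝ) * p ^ t * (1 - p) ^ (n - t) := by
      have : 0 ≤ 1 - p := by linarith
      positivity
    rw [integral_smul_measure, integral_dirac, ENNReal.toReal_ofReal this, smul_eq_mul]
  · intro i _
    exact (integrable_dirac (by simp)).smul_measure ENNReal.ofReal_ne_top

theorem aux_mean {Ω : Type*} [MeasurableSpace Ω] {P : Measure Ω} {Y : Ω → ℕ}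
    (hY : Measurable Y)
    {n : ℕ} {p : ℝ} (hp0 : 0 ≤ p) (hp1 : p ≤ 1) (hlaw : HasBinomialLaw P Y n p) :
    ∫ ω, (Y ω : ℝ) ∂P = n * p := by
  rw [aux_integral hY hp0 hp1 hlaw (fun t => (t : ℝ))]
  have h := congrArg (Polynomial.eval p) (bernsteinPolynomial.sum_smul ℝ n)
  simp only [Polynomial.eval_finsetSum, bernsteinPolynomial, nsmul_eq_mul, Polynomial.eval_mul,
    Polynomial.eval_natCast, Polynomial.eval_pow, Polynomial.eval_sub, Polynomial.eval_one,
    Polynomial.eval_X] at h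
  rw [← h]
  exact Finset.sum_congr rfl fun t _ => by ring

theorem aux_var {Ω : Type*} [MeasurableSpace Ω] {P : Measure Ω} {Y : Ω → ℕ}
    (hY : Measurable Y)
    {n : ℕ} {p : ℝ} (hp0 : 0 ≤ p) (hp1 : p ≤ 1) (hlaw : HasBinomialLaw P Y n p) :
    ∫ ω, ((Y ω : ℝ) - n * p) ^ 2 ∂P = n * p * (1 - p) := by
  rw [aux_integral hY hp0 hp1 hlaw (fun t => ((t : ℝ) - n * p) ^ 2)]
  have h := congrArg (Polynomial.eval p) (bernsteinPolynomial.variance ℝ n)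
  simp only [Polynomial.eval_finsetSum, bernsteinPolynomial, nsmul_eq_mul, Polynomial.eval_mul,
    Polynomial.eval_natCast, Polynomial.eval_pow, Polynomial.eval_sub, Polynomial.eval_one,
    Polynomial.eval_X] at h
  rw [← h]
  exact Finset.sum_congr rfl fun t _ => by ring

theorem aux_abs {Ω : Type*} [MeasurableSpace Ω] {P : Measure Ω} [IsProbabilityMeasure P]
    {Z : Ω → ℝ} (hZ : Integrable Z P) (hZ2 : Integrable (fun ω => Z ω ^ 2) P) {s : ℝ} (hs : 0 < s)
    (h : ∫ ω, Z ω ^ 2 ∂P ≤ s ^ 2) : ∫ ω, |Z ω| ∂P ≤ s := by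
  have h1 : ∫ ω, |Z ω| ∂P ≤ ∫ ω, (Z ω ^ 2 + s ^ 2) / (2 * s) ∂P := by
    apply integral_mono hZ.abs ((hZ2.add (integrable_const _)).div_const _)
    intro ω
    change |Z ω| ≤ (Z ω ^ 2 + s ^ 2) / (2 * s)
    rw [le_div_iff₀ (by positivity)]
    nlinarith [sq_nonneg (|Z ω| - s), sq_abs (Z ω)]
  rw [integral_div, integral_add hZ2 (integrable_const _)] at h1
  simp only [integral_const, probReal_univ, one_smul] at h1
  refine h1.trans ?_
  rw [div_le_iff₀ (by positivity)]
  nlinarith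

/-- **Lemma H.1 (Bias of the clipped logit of a Gaussian-perturbed binomial
proportion).** Fix `ε, δ ∈ (0,1)`, `β ∈ (1/2, 1)`, `n ≥ 1` and `p ∈ [1−β, β]`. Let
`Y_n ~ Binomial(n, p)` and `X̃_n = Y_n/n + ξ_n` with `ξ_n` an independent Gaussian of
mean `0` and variance `2·log(1.25/δ)/(εn)²`. Then
`|E[f(X̃_n)] − f(E[X̃_n])| ≤ 3/((1−β)⁴·√(2n)) + 4·√(log(1.25/δ))/((1−β)⁴·εn)`. -/
theorem gaussian_perturbed_binomial_clipped_logit_bias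
    (ε δ : ℝ) (hε : ε ∈ Set.Ioo (0 : ℝ) 1) (hδ : δ ∈ Set.Ioo (0 : ℝ) 1)
    (β : ℝ) (hβ : β ∈ Set.Ioo (1 / 2 : ℝ) 1)
    (n : ℕ) (hn : 1 ≤ n) (p : ℝ) (hp : p ∈ Set.Icc (1 - β) β)
    (Ω : Type) [MeasurableSpace Ω] (P : Measure Ω) [IsProbabilityMeasure P]
    (Y : Ω → ℕ) (hY : Measurable Y) (hlaw : HasBinomialLaw P Y n p)
    (ξ : Ω → ℝ) (hξ : Measurable ξ)
    (hξlaw : P.map ξ =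
      ProbabilityTheory.gaussianReal 0
        (Real.toNNReal (2 * Real.log (1.25 / δ) / (ε * n) ^ 2)))
    (hindep : ProbabilityTheory.IndepFun (fun ω => (Y ω : ℝ)) ξ P) :
    |(∫ ω, flog β ((Y ω : ℝ) / n + ξ ω) ∂P) -
        flog β (∫ ω, ((Y ω : ℝ) / n + ξ ω) ∂P)| ≤
      3 / ((1 - β) ^ 4 * Real.sqrt (2 * n)) +
        4 * Real.sqrt (Real.log (1.25 / δ)) / ((1 - β) ^ 4 * (ε * n)) := by
  obtain ⟨hε0, hε1⟩ := hε
  obtain ⟨hδ0, hδ1⟩ := hδ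
  have hβ' := hβ
  obtain ⟨hβ0, hβ1⟩ := hβ
  obtain ⟨hp0, hp1⟩ := hp
  have hn0 : (0 : ℝ) < n := by exact_mod_cast hn
  have hL : 0 < Real.log (1.25 / δ) := by
    apply Real.log_pos
    rw [lt_div_iff₀ hδ0]
    linarith
  set L := Real.log (1.25 / δ) with hLdef
  have hP0 : 0 ≤ p := by linarith
  have hP1 : p ≤ 1 := by linarith
  -- the Gaussian part
  have hv : 0 < 2 * L / (ε * n) ^ 2 := by positivity
  have hξ1 : Integrable ξ P := by
    have : Integrable id (P.map ξ) := by
      rw [hξlaw]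
      exact (memLp_id_gaussianReal' 1 (by simp)).integrable le_rfl
    exact this.comp_measurable hξ
  have hξ2 : Integrable (fun ω => ξ ω ^ 2) P := by
    have : Integrable (fun x : ℝ => x ^ 2) (P.map ξ) := by
      rw [hξlaw]
      exact (memLp_id_gaussianReal' 2 (by simp)).integrable_sq
    exact this.comp_measurable hξ
  have hξm : ∫ ω, ξ ω ∂P = 0 := by
    rw [← integral_map (f := fun x : ℝ => x) hξ.aemeasurable (by fun_prop), hξlaw]
    exact integral_id_gaussianReal
  have hξv : ∫ ω, ξ ω ^ 2 ∂P = 2 * L / (ε * n) ^ 2 := by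
    rw [← integral_map (f := fun x : ℝ => x ^ 2) hξ.aemeasurable (by fun_prop), hξlaw]
    have h := variance_fun_id_gaussianReal (μ := 0) (v := Real.toNNReal (2 * L / (ε * n) ^ 2))
    rw [variance_of_integral_eq_zero (by fun_prop) integral_id_gaussianReal,
      Real.coe_toNNReal _ hv.le] at h
    exact h
  have hξa : ∫ ω, |ξ ω| ∂P ≤ 2 * Real.sqrt L / (ε * n) := by
    apply aux_abs hξ1 hξ2 (by positivity)
    rw [hξv, div_pow, mul_pow 2 (Real.sqrt L), Real.sq_sqrt hL.le]
    gcongr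
    norm_num
  -- the binomial part
  have hYi : Integrable (fun ω => (Y ω : ℝ)) P := aux_integrable hY hlaw (fun t => (t : ℝ))
  have hYm := aux_mean hY hP0 hP1 hlaw
  have hYv := aux_var hY hP0 hP1 hlaw
  have hYa : ∫ ω, |(Y ω : ℝ) - n * p| ∂P ≤ Real.sqrt n := by
    apply aux_abs (Z := fun ω => (Y ω : ℝ) - n * p) (hYi.sub (integrable_const _))
      (aux_integrable hY hlaw (fun t => ((t : ℝ) - n * p) ^ 2)) (by positivity)
    rw [hYv, Real.sq_sqrt hn0.le, mul_assoc]
    have hpp : p * (1 - p) ≤ 1 := by nlinarith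
    exact mul_le_of_le_one_right hn0.le hpp
  have hmean : ∫ ω, ((Y ω : ℝ) / n + ξ ω) ∂P = p := by
    rw [integral_add (hYi.div_const _) hξ1, integral_div, hYm, hξm]
    field_simp
    ring
  rw [hmean]
  have hK : 0 < 2 / (1 - β) := div_pos two_pos (by linarith)
  set B : Ω → ℝ := fun ω => 2 / (1 - β) * (|(Y ω : ℝ) - n * p| / n + |ξ ω|) with hB
  have hi1 : Integrable (fun ω => |(Y ω : ℝ) - n * p| / n) P :=
    ((hYi.sub (integrable_const _)).abs).div_const _
  have hBi : Integrable B P := (hi1.add hξ1.abs).const_mul _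
  have hpt : ∀ ω, |flog β ((Y ω : ℝ) / n + ξ ω) - flog β p| ≤ B ω := by
    intro ω
    refine (aux_flog_lip hβ' _ _).trans ?_
    simp only [hB]
    gcongr
    have h1 : (Y ω : ℝ) / n + ξ ω - p = ((Y ω : ℝ) - n * p) / n + ξ ω := by
      field_simp
      ring
    rw [h1]
    refine (abs_add_le _ _).trans ?_
    rw [abs_div, abs_of_pos hn0]
  have hmeas : Measurable (fun ω => flog β ((Y ω : ℝ) / n + ξ ω)) := by
    apply (aux_flog_meas hβ').comp
    have : Measurable (fun ω => (Y ω : ℝ)) := measurable_from_top.comp hY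
    fun_prop
  have hdi : Integrable (fun ω => flog β ((Y ω : ℝ) / n + ξ ω) - flog β p) P :=
    hBi.mono' (hmeas.sub_const _).aestronglyMeasurable (Filter.Eventually.of_forall hpt)
  have hfi : Integrable (fun ω => flog β ((Y ω : ℝ) / n + ξ ω)) P := by
    have := hdi.add (integrable_const (flog β p))
    refine this.congr (Filter.Eventually.of_forall fun ω => ?_)
    simp
  have heq : (∫ ω, flog β ((Y ω : ℝ) / n + ξ ω) ∂P) - flog β p =
      ∫ ω, (flog β ((Y ω : ℝ) / n + ξ ω) - flog β p) ∂P := by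
    rw [integral_sub hfi (integrable_const _)]
    simp
  rw [heq]
  have hb1 : |∫ ω, (flog β ((Y ω : ℝ) / n + ξ ω) - flog β p) ∂P| ≤ ∫ ω, B ω ∂P :=
    (abs_integral_le_integral_abs).trans (integral_mono hdi.abs hBi hpt)
  refine hb1.trans ?_
  simp only [hB]
  rw [integral_const_mul, integral_add hi1 hξ1.abs, integral_div]
  set c := 1 - β with hc
  have hc0 : 0 < c := by linarith
  have hc1 : c ≤ 1 / 2 := by linarith
  have hcK : 2 / c ≤ 1 / c ^ 4 := by
    rw [div_le_div_iff₀ hc0 (by positivity)]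
    have : c ^ 3 ≤ (1 / 2) ^ 3 := by gcongr
    nlinarith
  have hs : 0 < Real.sqrt n := Real.sqrt_pos.2 hn0
  have hs2 : Real.sqrt n ^ 2 = n := Real.sq_sqrt hn0.le
  have e1 : (∫ ω, |(Y ω : ℝ) - n * p| ∂P) / n ≤ 3 / Real.sqrt (2 * n) := by
    rw [Real.sqrt_mul (by norm_num)]
    have h2 : Real.sqrt 2 ≤ 3 := by
      rw [Real.sqrt_le_left (by norm_num)]
      norm_num
    have h20 : 0 < Real.sqrt 2 := by positivity
    rw [div_le_div_iff₀ hn0 (by positivity)]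
    calc (∫ ω, |(Y ω : ℝ) - n * p| ∂P) * (Real.sqrt 2 * Real.sqrt n)
        ≤ Real.sqrt n * (3 * Real.sqrt n) := by gcongr
      _ = 3 * n := by rw [← hs2]; ring_nf; simp [hs2]
  have e2 : ∫ ω, |ξ ω| ∂P ≤ 4 * Real.sqrt L / (ε * n) := by
    refine hξa.trans ?_
    gcongr
    norm_num
  have e3 : 3 / (c ^ 4 * Real.sqrt (2 * n)) + 4 * Real.sqrt L / (c ^ 4 * (ε * n)) =
      1 / c ^ 4 * (3 / Real.sqrt (2 * n) + 4 * Real.sqrt L / (ε * n)) := by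
    rw [mul_add, div_mul_div_comm, div_mul_div_comm, one_mul, one_mul]
  rw [e3]
  apply mul_le_mul hcK (add_le_add e1 e2) _ (by positivity)
  exact add_nonneg (div_nonneg (integral_nonneg fun _ => abs_nonneg _) hn0.le)
    (integral_nonneg fun _ => abs_nonneg _)
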